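/- arXiv:2504.14623 — 3 statements merged into one kernel-verified Lean document; each statement's English description precedes it below -/
import Mathlib

section
/- Let k ≥ 1, let t be a k-fair trace and let p ∈ P be a process with |view_p(t)| ≥ 2k − 2. Then for every index i < f(view_p(t), 2k−2) and every process p' ∈ P, Foata(t)_i = Foata(view_{p'}(t))_i. -/
variable {α P : Type*}

/-- One swap of two adjacent independent letters. -/
def SwapAdj [DecidableEq P] (loc : α → Finset P) (w w' : List α) : Prop :=
  ∃ (u v : List α) (a b : α), loc a ∩ loc b = ∅ ∧
    w = u ++ a :: b :: v ∧ w' = u ++ b :: a :: v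

/-- Trace equivalence: finitely many swaps of adjacent independent letters. -/
def TraceEquiv [DecidableEq P] (loc : α → Finset P) : List α → List α → Prop :=
  Relation.ReflTransGen (SwapAdj loc)

/-- The set of processes participating in a word. -/
def locWord [DecidableEq P] (loc : α → Finset P) (w : List α) : Finset P :=
  w.foldr (fun a s => loc a ∪ s) ∅

/-- The trace of `w` is `k`-fair: every factor of length at least `k` of every
linearisation involves all processes. -/
def IsFairTrace [DecidableEq P] [Fintype P] (loc : α → Finset P) (k : ℕ)
    (w : List α) : Prop :=
  ∀ w' u v x, TraceEquiv loc w w' → w' = u ++ v ++ x → k ≤ v.length →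
    locWord loc v = Finset.univ

/-- Helper (on the reversed word) computing the view of a set of processes:
scanning from the right, keep an event iff its location meets the set of
processes already known to be causally after it. -/
def viewRev [DecidableEq P] (loc : α → Finset P) : Finset P → List α → List α
  | _, [] => []
  | T, a :: w =>
    if (loc a ∩ T).Nonempty then a :: viewRev loc (T ∪ loc a) w
    else viewRev loc T w

/-- The view of a set `X` of processes in the trace of `w`, as a linearisation. -/
def viewWord [DecidableEq P] (loc : α → Finset P) (X : Finset P) (w : List α) : List α :=
  (viewRev loc X w.reverse).reverse

/-- Insertion of a letter in a (reversed) Foata normal form: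
the letter is placed in the step just after the last step containing a letter
dependent on it (in a fresh last step, resp. the first step, if this is the
last step, resp. if there is no such step). -/
def foataInsRev [DecidableEq α] [DecidableEq P] (loc : α → Finset P)
    (φ : List (Finset α)) (a : α) : List (Finset α) :=
  match φ.findIdx? (fun S => decide (∃ b ∈ S, (loc a ∩ loc b).Nonempty)) with
  | some 0 => {a} :: φ
  | some (i + 1) => φ.set i (insert a (φ.getD i ∅))
  | none =>
      if φ.isEmpty then [{a}]
      else φ.set (φ.length - 1) (insert a (φ.getD (φ.length - 1) ∅))

/-- The Foata normal form of (the trace of) a word, as its list of steps;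
`(foata loc w).getD i ∅` is the `i`-th step (0-based, `∅` beyond the length). -/
def foata [DecidableEq α] [DecidableEq P] (loc : α → Finset P) (w : List α) :
    List (Finset α) :=
  (w.foldl (foataInsRev loc) []).reverse

/-- `foataIdx loc w ℓ` is the largest (0-based) index `i` such that the steps of the
Foata normal form of `w` from index `i` on contain at least `ℓ` letters in total.
(0-based: it equals the paper's 1-based `f(t, ℓ)` minus one.) -/
noncomputable def foataIdx [DecidableEq α] [DecidableEq P] (loc : α → Finset P)
    (w : List α) (ℓ : ℕ) : ℕ :=
  sSup {i : ℕ | ℓ ≤ (((foata loc w).drop i).map Finset.card).sum}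

section Helpers

variable [DecidableEq P]

theorem viewRev_append_aux (loc : α → Finset P) (X : Finset P) (w : List α) (a : α) :
    viewWord loc X (w ++ [a]) =
      if (loc a ∩ X).Nonempty then viewWord loc (X ∪ loc a) w ++ [a] else viewWord loc X w := by
  unfold viewWord
  rw [List.reverse_append]
  simp only [List.reverse_cons, List.reverse_nil, List.nil_append, List.singleton_append, viewRev]
  split_ifs <;> simp

theorem view_sublist (loc : α → Finset P) (w : List α) :
    ∀ X, (viewWord loc X w).Sublist w := by
  induction w using List.reverseRecOn with
  | nil => intro X; simp [viewWord, viewRev]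
  | append_singleton w a ih =>
    intro X
    rw [viewRev_append_aux]
    split_ifs
    · exact (ih _).append (List.Sublist.refl _)
    · exact (ih _).trans (List.sublist_append_left _ _)

theorem mem_view_of_meets (loc : α → Finset P) (w : List α) :
    ∀ X x, x ∈ w → (loc x ∩ X).Nonempty → x ∈ viewWord loc X w := by
  induction w using List.reverseRecOn with
  | nil => intro X x hx; simp at hx
  | append_singleton w a ih =>
    intro X x hx hX
    rw [viewRev_append_aux]
    rw [List.mem_append, List.mem_singleton] at hx
    split_ifs with h
    · rcases hx with hx | hx
      · refine List.mem_append_left _ (ih _ _ hx ?_)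
        exact hX.mono (Finset.inter_subset_inter_left Finset.subset_union_left)
      · simp [hx]
    · rcases hx with hx | hx
      · exact ih _ _ hx hX
      · subst hx; exact absurd hX h

theorem SwapAdj.append (loc : α → Finset P) {w w' : List α} (s t : List α)
    (h : SwapAdj loc w w') : SwapAdj loc (s ++ w ++ t) (s ++ w' ++ t) := by
  obtain ⟨u, v, a, b, hab, rfl, rfl⟩ := h
  exact ⟨s ++ u, v ++ t, a, b, hab, by simp, by simp⟩

theorem TraceEquiv.append (loc : α → Finset P) {w w' : List α} (s t : List α)
    (h : TraceEquiv loc w w') : TraceEquiv loc (s ++ w ++ t) (s ++ w' ++ t) := by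
  induction h with
  | refl => exact Relation.ReflTransGen.refl
  | tail _ h ih => exact Relation.ReflTransGen.tail ih (SwapAdj.append loc s t h)

theorem TraceEquiv.perm (loc : α → Finset P) {w w' : List α}
    (h : TraceEquiv loc w w') : w.Perm w' := by
  induction h with
  | refl => exact List.Perm.refl _
  | tail _ h ih =>
    obtain ⟨u, v, a, b, hab, rfl, rfl⟩ := h
    exact ih.trans (List.Perm.append_left _ (List.Perm.swap _ _ _))

theorem TraceEquiv.map_of {β : Type*} (loc : α → Finset P) (g : β → α) {w w' : List β}
    (h : TraceEquiv (fun x => loc (g x)) w w') : TraceEquiv loc (w.map g) (w'.map g) := by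
  induction h with
  | refl => exact Relation.ReflTransGen.refl
  | tail _ h ih =>
    obtain ⟨u, v, a, b, hab, rfl, rfl⟩ := h
    exact Relation.ReflTransGen.tail ih
      ⟨u.map g, v.map g, g a, g b, hab, by simp, by simp⟩

theorem TraceEquiv.move (loc : α → Finset P) (a : α) (N : List α)
    (h : ∀ n ∈ N, loc n ∩ loc a = ∅) : TraceEquiv loc (N ++ [a]) (a :: N) := by
  induction N with
  | nil => exact Relation.ReflTransGen.refl
  | cons n N ih =>
    have h1 := (ih (fun m hm => h m (List.mem_cons_of_mem _ hm))).append loc [n] []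
    simp only [List.append_nil, List.singleton_append] at h1
    refine Relation.ReflTransGen.tail h1 ⟨[], N, n, a, h n (by simp), rfl, rfl⟩

theorem view_split (loc : α → Finset P) (w : List α) :
    ∀ X, ∃ N, TraceEquiv loc w (viewWord loc X w ++ N) ∧ ∀ n ∈ N, loc n ∩ X = ∅ := by
  induction w using List.reverseRecOn with
  | nil => intro X; exact ⟨[], Relation.ReflTransGen.refl, by simp⟩
  | append_singleton w a ih =>
    intro X
    rw [viewRev_append_aux]
    split_ifs with h
    · obtain ⟨N, h1, h2⟩ := ih (X ∪ loc a)
      refine ⟨N, ?_, ?_⟩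
      · have h3 := h1.append loc [] [a]
        have h4 : TraceEquiv loc (N ++ [a]) (a :: N) := by
          refine TraceEquiv.move loc a N fun n hn => ?_
          have := h2 n hn
          rw [Finset.inter_union_distrib_left, Finset.union_eq_empty] at this
          exact this.2
        have h5 := h4.append loc (viewWord loc (X ∪ loc a) w) []
        simp only [List.append_nil, List.nil_append, List.append_assoc] at h3 h5
        simp only [List.append_assoc, List.singleton_append]
        exact Relation.ReflTransGen.trans h3 h5
      · intro n hn
        have := h2 n hn
        rw [Finset.inter_union_distrib_left, Finset.union_eq_empty] at this
        exact this.1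
    · obtain ⟨N, h1, h2⟩ := ih X
      refine ⟨N ++ [a], ?_, ?_⟩
      · have h3 := h1.append loc [] [a]
        simpa using h3
      · intro n hn
        rw [List.mem_append, List.mem_singleton] at hn
        rcases hn with hn | rfl
        · exact h2 n hn
        · exact Finset.not_nonempty_iff_eq_empty.1 h

/-- the order-compatible labelling relation -/
def LvlRel (loc : α → Finset P) (x y : α × ℕ) : Prop :=
  (loc x.1 ∩ loc y.1).Nonempty → x.2 < y.2

theorem pairwise_of_equiv (loc : α → Finset P) {L L' : List (α × ℕ)}
    (h : TraceEquiv (fun x : α × ℕ => loc x.1) L L') (hL : L.Pairwise (LvlRel loc)) :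
    L'.Pairwise (LvlRel loc) := by
  induction h with
  | refl => exact hL
  | tail _ h ih =>
    obtain ⟨u, v, a, b, hab, rfl, rfl⟩ := h
    have hba : LvlRel loc b a := by
      intro h
      rw [Finset.inter_comm] at h
      simp [hab] at h
    simp only [List.pairwise_append, List.pairwise_cons, List.mem_cons] at ih ⊢
    grind

theorem split_level (loc : α → Finset P) (i : ℕ) (L : List (α × ℕ))
    (hL : L.Pairwise (LvlRel loc)) :
    TraceEquiv (fun x : α × ℕ => loc x.1) L
      (L.filter (fun x => x.2 ≤ i) ++ L.filter (fun x => i < x.2)) := by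
  induction L using List.reverseRecOn with
  | nil => exact Relation.ReflTransGen.refl
  | append_singleton L a ih =>
    rw [List.pairwise_append] at hL
    have h3 := (ih hL.1).append _ [] [a]
    simp only [List.nil_append] at h3
    by_cases h : i < a.2
    · have h' : ¬ a.2 ≤ i := by omega
      simpa [List.filter_append, h, h'] using h3
    · have h' : a.2 ≤ i := by omega
      have h4 := (TraceEquiv.move (fun x : α × ℕ => loc x.1) a (L.filter (fun x => i < x.2)) ?_).append
        _ (L.filter (fun x => x.2 ≤ i)) []
      · simp only [List.append_nil, List.append_assoc] at h3 h4
        have h5 : TraceEquiv (fun x : α × ℕ => loc x.1) _ _ := Relation.ReflTransGen.trans h3 h4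
        simpa [List.filter_append, h, h'] using h5
      · intro n hn
        simp only [List.mem_filter, decide_eq_true_eq] at hn
        by_contra hne
        have := hL.2.2 n hn.1 a (by simp) (Finset.nonempty_iff_ne_empty.2 hne)
        omega

theorem mem_locWord (loc : α → Finset P) (w : List α) (q : P) :
    q ∈ locWord loc w ↔ ∃ a ∈ w, q ∈ loc a := by
  induction w with
  | nil => simp [locWord]
  | cons a w ih =>
    have : locWord loc (a :: w) = loc a ∪ locWord loc w := rfl
    simp [this, ih]

variable [DecidableEq α]

/-- level of a new letter -/
def newLvl (loc : α → Finset P) (L : List (α × ℕ)) (a : α) : ℕ :=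
  (L.toFinset.filter (fun x => (loc a ∩ loc x.1).Nonempty)).sup (fun x => x.2 + 1)

/-- word annotated with levels -/
def ann (loc : α → Finset P) (w : List α) : List (α × ℕ) :=
  w.foldl (fun L a => L ++ [(a, newLvl loc L a)]) []

theorem ann_append (loc : α → Finset P) (w : List α) (a : α) :
    ann loc (w ++ [a]) = ann loc w ++ [(a, newLvl loc (ann loc w) a)] := by
  simp [ann]

theorem ann_map (loc : α → Finset P) (w : List α) : (ann loc w).map Prod.fst = w := by
  induction w using List.reverseRecOn with
  | nil => rfl
  | append_singleton w a ih => simp [ann_append, ih]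

theorem ann_pairwise (loc : α → Finset P) (w : List α) :
    (ann loc w).Pairwise (LvlRel loc) := by
  induction w using List.reverseRecOn with
  | nil => exact List.Pairwise.nil
  | append_singleton w a ih =>
    rw [ann_append, List.pairwise_append]
    refine ⟨ih, by simp, ?_⟩
    intro x hx y hy hxy
    rw [List.mem_singleton] at hy
    subst hy
    have : x.2 + 1 ≤ newLvl loc (ann loc w) a := by
      unfold newLvl
      refine Finset.le_sup (f := fun x : α × ℕ => x.2 + 1) ?_
      rw [Finset.inter_comm] at hxy
      simp only [Finset.mem_filter, List.mem_toFinset]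
      exact ⟨hx, hxy⟩
    exact this

theorem ann_view (loc : α → Finset P) (w : List α) :
    ∀ X, ann loc (viewWord loc X w) = viewWord (fun x : α × ℕ => loc x.1) X (ann loc w) := by
  induction w using List.reverseRecOn with
  | nil => intro X; rfl
  | append_singleton w a ih =>
    intro X
    rw [ann_append, viewRev_append_aux, viewRev_append_aux]
    split_ifs with h
    · rw [ann_append, ih]
      congr 3
      unfold newLvl
      congr 1
      ext x
      simp only [Finset.mem_filter, List.mem_toFinset, and_congr_left_iff]
      intro hx
      refine ⟨fun h => (view_sublist _ _ _).subset h, fun h => mem_view_of_meets _ _ _ _ h ?_⟩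
      rw [Finset.inter_comm] at hx
      exact hx.mono (Finset.inter_subset_inter_left Finset.subset_union_right)
    · exact ih X

theorem ins_spec (loc : α → Finset P) (φ : List (Finset α)) (a : α) :
    ∃ m, (∀ n, (foataInsRev loc φ a).reverse.getD n ∅ =
        if n = m then insert a (φ.reverse.getD n ∅) else φ.reverse.getD n ∅) ∧
      (∀ m', m = m' + 1 → ∃ b ∈ φ.reverse.getD m' ∅, (loc a ∩ loc b).Nonempty) ∧
      (∀ n, m ≤ n → ∀ b ∈ φ.reverse.getD n ∅, ¬ (loc a ∩ loc b).Nonempty) := by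
  have hrev : ∀ (ψ : List (Finset α)) n, ψ.reverse.getD n ∅ =
      if n < ψ.length then ψ.getD (ψ.length - 1 - n) ∅ else ∅ := by
    intro ψ n
    split_ifs with h
    · simp [List.getD_eq_getElem?_getD, List.getElem?_reverse h]
    · rw [List.getD_eq_default]; simpa using h
  unfold foataInsRev
  split
  · rename_i h
    rw [List.findIdx?_eq_some_iff_getElem] at h
    obtain ⟨h0, h1, h2⟩ := h
    refine ⟨φ.length, ?_, ?_, ?_⟩
    · intro n
      simp only [hrev, List.length_cons]
      rcases lt_trichotomy n φ.length with h | h | h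
      · have e : φ.length + 1 - 1 - n = (φ.length - 1 - n) + 1 := by omega
        rw [e]
        simp [h, h.ne, show n < φ.length + 1 by omega]
      · subst h; simp
      · simp [h.ne', show ¬ n < φ.length + 1 by omega, show ¬ n < φ.length by omega]
    · intro m' hm
      rw [hrev, if_pos (by omega)]
      have : φ.length - 1 - m' = 0 := by omega
      rw [this, List.getD_eq_getElem _ _ h0]
      simpa using h1
    · intro n hn b hb
      rw [hrev, if_neg (by omega)] at hb
      simp at hb
  · rename_i i h
    rw [List.findIdx?_eq_some_iff_getElem] at h
    obtain ⟨h0, h1, h2⟩ := h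
    refine ⟨φ.length - 1 - i, ?_, ?_, ?_⟩
    · intro n
      simp only [hrev, List.length_set]
      by_cases hn : n < φ.length
      · simp only [hn, if_true]
        rw [List.getD_eq_getElem _ _ (by simp; omega), List.getElem_set]
        by_cases hh : n = φ.length - 1 - i
        · have : i = φ.length - 1 - n := by omega
          simp [← hh, ← this]
        · have : ¬ i = φ.length - 1 - n := by omega
          rw [if_neg this, if_neg hh]
          exact (List.getD_eq_getElem _ _ (by omega)).symm
      · have : ¬ n = φ.length - 1 - i := by omega
        simp [hn, this]
    · intro m' hm
      rw [hrev, if_pos (by omega)]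
      have : φ.length - 1 - m' = i + 1 := by omega
      rw [this, List.getD_eq_getElem _ _ h0]
      simpa using h1
    · intro n hn b hb hne
      rw [hrev] at hb
      split_ifs at hb with hl
      · rw [List.getD_eq_getElem _ _ (by omega)] at hb
        have := h2 (φ.length - 1 - n) (by omega)
        simp only [decide_eq_true_eq] at this
        exact this ⟨b, hb, hne⟩
      · simp at hb
  · rename_i h
    rw [List.findIdx?_eq_none_iff] at h
    have hno : ∀ n, ∀ b ∈ φ.reverse.getD n ∅, ¬ (loc a ∩ loc b).Nonempty := by
      intro n b hb hne
      by_cases hl : n < φ.reverse.length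
      · rw [List.getD_eq_getElem _ _ hl] at hb
        have := h _ (List.mem_reverse.1 (List.getElem_mem hl))
        simp only [decide_eq_false_iff_not] at this
        exact this ⟨b, hb, hne⟩
      · rw [List.getD_eq_default _ _ (by omega)] at hb
        simp at hb
    refine ⟨0, ?_, by omega, fun n _ => hno n⟩
    intro n
    by_cases he : φ = []
    · subst he
      rcases n with _ | n <;> simp
    · have hpos := List.length_pos_iff.2 he
      have : φ.isEmpty = false := by simpa using he
      rw [this]
      simp only [hrev, Bool.false_eq_true, if_false, List.length_set]
      by_cases hn : n < φ.length
      · simp only [hn, if_true]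
        rw [List.getD_eq_getElem _ _ (by simp; omega), List.getElem_set]
        by_cases hh : n = 0
        · subst hh; simp
        · have : ¬ φ.length - 1 = φ.length - 1 - n := by omega
          rw [if_neg this, if_neg hh]
          exact (List.getD_eq_getElem _ _ (by omega)).symm
      · have : ¬ n = 0 := by omega
        simp [hn, this]

theorem mem_foata (loc : α → Finset P) (w : List α) :
    ∀ n b, b ∈ (foata loc w).getD n ∅ ↔ (b, n) ∈ ann loc w := by
  induction w using List.reverseRecOn with
  | nil => intro n b; simp [foata, ann]
  | append_singleton w a ih =>
    intro n b
    have hf : foata loc (w ++ [a]) =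
        (foataInsRev loc (w.foldl (foataInsRev loc) []) a).reverse := by simp [foata]
    obtain ⟨m, h1, h2, h3⟩ := ins_spec loc (w.foldl (foataInsRev loc) []) a
    change ∀ n b, b ∈ (w.foldl (foataInsRev loc) []).reverse.getD n ∅ ↔ _ at ih
    rw [hf, h1, ann_append]
    have hm : newLvl loc (ann loc w) a = m := by
      unfold newLvl
      apply le_antisymm
      · refine Finset.sup_le ?_
        rintro ⟨c, l⟩ hx
        simp only [Finset.mem_filter, List.mem_toFinset] at hx
        by_contra hlt
        exact h3 l (by simpa using Nat.le_of_lt_succ (not_le.1 hlt)) c ((ih _ _).2 hx.1) hx.2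
      · rcases m with _ | m'
        · exact Nat.zero_le _
        · obtain ⟨c, hc, hd⟩ := h2 m' rfl
          refine Finset.le_sup (f := fun x : α × ℕ => x.2 + 1) (b := (c, m')) ?_
          simp only [Finset.mem_filter, List.mem_toFinset]
          exact ⟨(ih _ _).1 hc, hd⟩
    rw [hm]
    split_ifs with hn
    · subst hn
      rw [Finset.mem_insert, ih]
      simp [or_comm]
    · rw [ih]; simp [hn]

theorem sum_drop (l : List (Finset α)) : ∀ j,
    ((l.drop j).map Finset.card).sum = ∑ n ∈ Finset.Ico j l.length, (l.getD n ∅).card := by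
  intro j
  rw [Finset.sum_Ico_eq_sum_range, ← Fin.sum_univ_eq_sum_range
    (fun n => (l.getD (j + n) ∅).card), ← List.sum_ofFn]
  congr 1
  apply List.ext_getElem
  · simp
  · intro n h1 h2
    simp only [List.length_map, List.length_drop] at h1
    simp only [List.getElem_map, List.getElem_drop, List.getElem_ofFn]
    rw [List.getD_eq_getElem _ _ (by omega)]

theorem sum_le (loc : α → Finset P) (w : List α) (j : ℕ) :
    (((foata loc w).drop j).map Finset.card).sum ≤
      ((ann loc w).filter (fun x => j ≤ x.2)).length := by
  rw [sum_drop]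
  have h1 : ∑ n ∈ Finset.Ico j (foata loc w).length, ((foata loc w).getD n ∅).card
      ≤ ((Finset.Ico j (foata loc w).length).sigma (fun n => (foata loc w).getD n ∅)).card := by
    rw [Finset.card_sigma]
  refine h1.trans ?_
  refine le_trans ?_ (List.toFinset_card_le _)
  refine Finset.card_le_card_of_injOn (fun x => (x.2, x.1)) ?_ ?_
  · rintro ⟨n, b⟩ h
    simp only [Finset.coe_sigma, Set.mem_sigma_iff, Finset.mem_coe, Finset.mem_Ico] at h
    have := (mem_foata loc w n b).1 h.2
    simp [this, h.1.1]
  · rintro ⟨n, b⟩ _ ⟨n', b'⟩ _ h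
    simp only [Prod.mk.injEq] at h
    obtain ⟨rfl, rfl⟩ := h
    rfl

end Helpers

/-- For a `k`-fair trace `t` and a process `p` whose view has
length at least `2k - 2`, all Foata steps of index `< f(view_p(t), 2k-2)` of the
full trace coincide with those of the view of every process `p'`. (0-based.) -/
theorem foata_eq_on_all_views_of_fair [DecidableEq α] [DecidableEq P]
    [Fintype α] [Fintype P]
    (loc : α → Finset P) (hloc : ∀ a, (loc a).Nonempty)
    (k : ℕ) (hk : 1 ≤ k) (w : List α) (hfair : IsFairTrace loc k w)
    (p : P) (hlen : 2 * k - 2 ≤ (viewWord loc {p} w).length) :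
    ∀ i < foataIdx loc (viewWord loc {p} w) (2 * k - 2), ∀ p' : P,
      (foata loc w).getD i ∅ = (foata loc (viewWord loc {p'} w)).getD i ∅ := by
  intro i hi p'
  set S := {i : ℕ | 2 * k - 2 ≤ (((foata loc (viewWord loc {p} w)).drop i).map Finset.card).sum}
    with hS
  have hi' : i < sSup S := hi
  have hne : S.Nonempty := by
    by_contra h
    rw [Set.not_nonempty_iff_eq_empty] at h
    rw [h] at hi'
    simp at hi'
  obtain ⟨j, hj, hij⟩ := exists_lt_of_lt_csSup hne hi'
  have hcount : 2 * k - 2 ≤ ((ann loc w).filter (fun x => i < x.2)).length := by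
    refine (hj.trans (sum_le loc _ j)).trans ?_
    rw [ann_view]
    refine le_trans ((view_sublist _ _ _).filter _).length_le ?_
    refine (List.monotone_filter_right _ ?_).length_le
    intro x hx
    simp only [decide_eq_true_eq] at hx ⊢
    omega
  ext a
  rw [mem_foata, mem_foata, ann_view]
  refine ⟨fun ha => ?_, fun h => (view_sublist _ _ _).subset h⟩
  by_contra hnot
  obtain ⟨N, hN1, hN2⟩ := view_split (fun x : α × ℕ => loc x.1) (ann loc w) {p'}
  set V := viewWord (fun x : α × ℕ => loc x.1) {p'} (ann loc w) with hV
  have hpw := pairwise_of_equiv loc hN1 (ann_pairwise loc w)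
  have hperm := hN1.perm
  have haN : (a, i) ∈ N := by
    have := hperm.subset ha
    rw [List.mem_append] at this
    exact this.resolve_left hnot
  have hw : ∀ {M}, TraceEquiv (fun x : α × ℕ => loc x.1) (ann loc w) M →
      TraceEquiv loc w (M.map Prod.fst) := by
    intro M h
    have := TraceEquiv.map_of loc Prod.fst h
    rwa [ann_map] at this
  have hNk : N.length < k := by
    by_contra hge
    have hu := hfair _ (V.map Prod.fst) (N.map Prod.fst) [] (hw hN1) (by simp)
      (by simpa using hge)
    have hp : p' ∈ locWord loc (N.map Prod.fst) := by rw [hu]; exact Finset.mem_univ _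
    rw [mem_locWord] at hp
    obtain ⟨b, hb, hpb⟩ := hp
    obtain ⟨x, hx, rfl⟩ := List.mem_map.1 hb
    have := hN2 x hx
    have hmem : p' ∈ loc x.1 ∩ {p'} := by simp [hpb]
    rw [this] at hmem
    simp at hmem
  have hNf : (N.filter (fun x => i < x.2)).length < N.length := by
    rw [List.length_filter_lt_length_iff_exists]
    exact ⟨(a, i), haN, by simp⟩
  have hVk : k ≤ (V.filter (fun x => i < x.2)).length := by
    have := (hperm.filter (fun x => i < x.2)).length_eq
    rw [List.filter_append, List.length_append] at this
    omega
  have hpwV := (List.pairwise_append.1 hpw)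
  have hsp := (split_level loc i V hpwV.1).append _ [] N
  simp only [List.nil_append] at hsp
  have hu := hfair _ ((V.filter (fun x => x.2 ≤ i)).map Prod.fst)
    ((V.filter (fun x => i < x.2)).map Prod.fst) (N.map Prod.fst)
    (hw (Relation.ReflTransGen.trans hN1 hsp)) (by simp) (by simpa using hVk)
  obtain ⟨q, hq⟩ := hloc a
  have hqm : q ∈ locWord loc ((V.filter (fun x => i < x.2)).map Prod.fst) := by
    rw [hu]; exact Finset.mem_univ _
  rw [mem_locWord] at hqm
  obtain ⟨b, hb, hqb⟩ := hqm
  obtain ⟨x, hx, rfl⟩ := List.mem_map.1 hb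
  simp only [List.mem_filter, decide_eq_true_eq] at hx
  have hlt := hpwV.2.2 x hx.1 (a, i) haN ⟨q, Finset.mem_inter.2 ⟨hqb, hq⟩⟩
  simp only at hlt
  omega
end

section
/- Let k ≥ 1 and let t be a k-fair trace. Then every step of the Foata normal form of t contains at most k letters. -/
variable {α P : Type*}

theorem te_ctx [DecidableEq P] (loc : α → Finset P) (u v : List α) {x y : List α}
    (h : TraceEquiv loc x y) : TraceEquiv loc (u ++ x ++ v) (u ++ y ++ v) := by
  refine Relation.ReflTransGen.lift (fun z => u ++ z ++ v) ?_ _ _ h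
  rintro _ _ ⟨p, q, a, b, hab, rfl, rfl⟩
  exact ⟨u ++ p, q ++ v, a, b, hab, by simp, by simp⟩

theorem te_move [DecidableEq P] (loc : α → Finset P) (a : α) (l : List α)
    (h : ∀ b ∈ l, loc a ∩ loc b = ∅) : TraceEquiv loc (l ++ [a]) (a :: l) := by
  induction l with
  | nil => exact Relation.ReflTransGen.refl
  | cons b l ih =>
    have h1 := te_ctx loc [b] [] (ih (fun c hc => h c (by simp [hc])))
    refine Relation.ReflTransGen.trans (by simpa [TraceEquiv] using h1) (Relation.ReflTransGen.single ?_)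
    exact ⟨[], l, b, a, by rw [Finset.inter_comm]; exact h b (by simp), rfl, rfl⟩

theorem te_perm [DecidableEq P] (loc : α → Finset P) {l m : List α} (p : l.Perm m)
    (h : l.Pairwise (fun a b => loc a ∩ loc b = ∅)) : TraceEquiv loc l m := by
  induction p with
  | nil => exact Relation.ReflTransGen.refl
  | cons a p ih =>
    have h1 := te_ctx loc [a] [] (ih (List.pairwise_cons.1 h).2)
    simpa using h1
  | swap a b l =>
    refine Relation.ReflTransGen.single ⟨[], l, b, a, ?_, rfl, rfl⟩
    exact (List.pairwise_cons.1 h).1 a (by simp)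
  | trans p q ih1 ih2 =>
    exact (ih1 h).trans (ih2 ((p.pairwise_iff (fun {a b} hab => by
      rw [Finset.inter_comm]; exact hab)).1 h))

noncomputable def flatRev (φ : List (Finset α)) : List α :=
  (φ.map Finset.toList).reverse.flatten

def GoodF [DecidableEq P] (loc : α → Finset P) (w : List α) (φ : List (Finset α)) : Prop :=
  (∀ S ∈ φ, ∀ a ∈ S, ∀ b ∈ S, a ≠ b → loc a ∩ loc b = ∅) ∧ TraceEquiv loc w (flatRev φ)

theorem pw_toList [DecidableEq P] (loc : α → Finset P) (S : Finset α)
    (h : ∀ a ∈ S, ∀ b ∈ S, a ≠ b → loc a ∩ loc b = ∅) :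
    S.toList.Pairwise (fun a b => loc a ∩ loc b = ∅) := by
  refine List.Pairwise.imp_of_mem ?_ S.nodup_toList
  intro a b ha hb hab
  exact h a (by simpa using ha) b (by simpa using hb) hab

theorem good_fresh [DecidableEq P] (loc : α → Finset P) {w : List α}
    {φ : List (Finset α)} (a : α) (h : GoodF loc w φ) :
    GoodF loc (w ++ [a]) ({a} :: φ) := by
  refine ⟨?_, ?_⟩
  · intro S hS
    rcases List.mem_cons.1 hS with rfl | hS
    · intro x hx y hy hxy
      simp at hx hy
      exact absurd (hx.trans hy.symm) hxy
    · exact h.1 S hS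
  · have := te_ctx loc [] [a] h.2
    simpa [flatRev] using this

theorem good_ins [DecidableEq α] [DecidableEq P] (loc : α → Finset P)
    (hloc : ∀ a, (loc a).Nonempty) {w : List α}
    {φ : List (Finset α)} (a : α) (h : GoodF loc w φ) (i : ℕ) (hi : i < φ.length)
    (hind : ∀ j (_ : j ≤ i) (hj : j < φ.length), ∀ b ∈ φ[j], loc a ∩ loc b = ∅) :
    GoodF loc (w ++ [a]) (φ.set i (insert a (φ.getD i ∅))) := by
  obtain ⟨pre, S, suf, rfl, rfl⟩ : ∃ pre S suf, φ = pre ++ S :: suf ∧ i = pre.length :=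
    ⟨φ.take i, φ[i], φ.drop (i+1), by simp, by simp; omega⟩
  have hS : ∀ b ∈ S, loc a ∩ loc b = ∅ := by
    have := hind pre.length le_rfl hi
    simpa using this
  have hpre : ∀ T ∈ pre, ∀ b ∈ T, loc a ∩ loc b = ∅ := by
    intro T hT
    obtain ⟨j, hj, rfl⟩ := List.getElem_of_mem hT
    have := hind j hj.le (by simp; omega)
    simpa [List.getElem_append_left hj] using this
  have haS : a ∉ S := fun ha => by
    have := hS a ha
    rw [Finset.inter_self] at this
    exact (hloc a).ne_empty this
  have e : (pre ++ S :: suf).set pre.length (insert a ((pre ++ S :: suf).getD pre.length ∅))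
      = pre ++ insert a S :: suf := by simp
  rw [e]
  have hpw : ∀ x ∈ insert a S, ∀ y ∈ insert a S, x ≠ y → loc x ∩ loc y = ∅ := by
    intro x hx y hy hxy
    rcases Finset.mem_insert.1 hx with ex | hx1
    · rcases Finset.mem_insert.1 hy with ey | hy1
      · exact absurd (ex.trans ey.symm) hxy
      · rw [ex]; exact hS y hy1
    · rcases Finset.mem_insert.1 hy with ey | hy1
      · rw [ey, Finset.inter_comm]; exact hS x hx1
      · exact h.1 S (by simp) x hx1 y hy1 hxy
  refine ⟨?_, ?_⟩
  · intro T hT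
    simp only [List.mem_append, List.mem_cons] at hT
    rcases hT with hT | rfl | hT
    · exact h.1 T (by simp [hT])
    · exact hpw
    · exact h.1 T (by simp [hT])
  · have h1 := te_ctx loc [] [a] h.2
    have h2 := te_ctx loc (flatRev suf ++ S.toList) [] (te_move loc a (flatRev pre) (by
      intro b hb
      simp only [flatRev, List.mem_flatten, List.mem_reverse, List.mem_map] at hb
      obtain ⟨_, ⟨T, hT, rfl⟩, hb⟩ := hb
      exact hpre T hT b (by simpa using hb)))
    have hp : (insert a S).toList.Perm (S.toList ++ [a]) :=
      (Finset.toList_insert haS).trans (List.perm_append_singleton a S.toList).symm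
    have h3 := te_ctx loc (flatRev suf) (flatRev pre) (te_perm loc hp.symm
      ((hp.pairwise_iff (fun {a b} hab => by
        rw [Finset.inter_comm]; exact hab)).1 (pw_toList loc _ hpw)))
    have g1 : TraceEquiv loc (w ++ [a]) (flatRev (pre ++ S :: suf) ++ [a]) := by simpa using h1
    have g2 : TraceEquiv loc (flatRev (pre ++ S :: suf) ++ [a])
        (flatRev suf ++ (S.toList ++ [a]) ++ flatRev pre) := by simpa [flatRev] using h2
    have g3 : TraceEquiv loc (flatRev suf ++ (S.toList ++ [a]) ++ flatRev pre)
        (flatRev (pre ++ insert a S :: suf)) := by simpa [flatRev] using h3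
    exact Relation.ReflTransGen.trans g1 (Relation.ReflTransGen.trans g2 g3)

theorem good_step [DecidableEq α] [DecidableEq P] (loc : α → Finset P)
    (hloc : ∀ a, (loc a).Nonempty) {w : List α}
    {φ : List (Finset α)} (a : α) (h : GoodF loc w φ) :
    GoodF loc (w ++ [a]) (foataInsRev loc φ a) := by
  unfold foataInsRev
  split
  · exact good_fresh loc a h
  · rename_i i heq
    rw [List.findIdx?_eq_some_iff_getElem] at heq
    obtain ⟨hi, -, h2⟩ := heq
    refine good_ins loc hloc a h i (by omega) ?_
    intro j hj hjl b hb
    have := h2 j (by omega)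
    by_contra hc
    apply this
    simp only [decide_eq_true_eq]
    exact ⟨b, hb, Finset.nonempty_iff_ne_empty.2 hc⟩
  · rename_i heq
    rw [List.findIdx?_eq_none_iff] at heq
    split
    · rename_i he
      rw [List.isEmpty_iff] at he
      subst he
      exact good_fresh loc a h
    · rename_i he
      rw [List.isEmpty_iff] at he
      have := List.length_pos_iff.2 he
      refine good_ins loc hloc a h _ (by omega) ?_
      intro j hj hjl b hb
      have := heq φ[j] (List.getElem_mem hjl)
      by_contra hc
      rw [decide_eq_false_iff_not] at this
      exact this ⟨b, hb, Finset.nonempty_iff_ne_empty.2 hc⟩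

theorem good_all [DecidableEq α] [DecidableEq P] (loc : α → Finset P)
    (hloc : ∀ a, (loc a).Nonempty) (w : List α) :
    GoodF loc w (w.foldl (foataInsRev loc) []) := by
  induction w using List.reverseRecOn with
  | nil => exact ⟨by simp, Relation.ReflTransGen.refl⟩
  | append_singleton l a ih =>
    rw [List.foldl_append]
    exact good_step loc hloc a ih

theorem mem_locWord' [DecidableEq P] (loc : α → Finset P) (p : P) (v : List α)
    (h : p ∈ locWord loc v) : ∃ b ∈ v, p ∈ loc b := by
  induction v with
  | nil => simp [locWord] at h
  | cons c v ih =>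
    have h' : p ∈ loc c ∪ locWord loc v := h
    rcases Finset.mem_union.1 h' with h' | h'
    · exact ⟨c, by simp, h'⟩
    · obtain ⟨b, hb, hp⟩ := ih h'
      exact ⟨b, by simp [hb], hp⟩

/-- Every step of the Foata normal form of a `k`-fair trace
contains at most `k` letters. -/
theorem card_foata_step_le_of_fair [DecidableEq α] [DecidableEq P]
    [Fintype α] [Fintype P]
    (loc : α → Finset P) (hloc : ∀ a, (loc a).Nonempty)
    (k : ℕ) (hk : 1 ≤ k) (w : List α) (hfair : IsFairTrace loc k w) :
    ∀ S ∈ foata loc w, S.card ≤ k := by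
  intro S hS
  by_contra! hc
  obtain ⟨h1, h2⟩ := good_all loc hloc w
  rw [foata, List.mem_reverse] at hS
  have hpw := pw_toList loc S (h1 S hS)
  obtain ⟨pre, suf, e⟩ := List.append_of_mem hS
  rw [e] at h2
  have hl : S.toList.length = S.card := S.length_toList
  cases hS' : S.toList with
  | nil => simp [hS'] at hl; omega
  | cons a l =>
    rw [hS'] at hpw hl
    have h3 := hfair _ (flatRev suf ++ [a]) l (flatRev pre) h2 (by simp [flatRev, hS'])
      (by simp at hl; omega)
    obtain ⟨p, hp⟩ := hloc a
    obtain ⟨b, hb, hpb⟩ := mem_locWord' loc p l (by rw [h3]; simp)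
    have := (List.pairwise_cons.1 hpw).1 b hb
    have hm := Finset.mem_inter.2 ⟨hp, hpb⟩
    rw [this] at hm
    simp at hm
end

section
/- Let A be a trim DFA over Σ (every state is reachable from the initial state and co-reachable to a final state) with state set Q, satisfying the diamond property with respect to I. Then A is k-fair for some integer k ≥ 1 if and only if A is |Q|-fair. -/
variable {α P : Type*}

/-- Deterministic finite-state automaton with partial transition function. -/
structure DetAut (α Q : Type*) where
  init : Q
  step : Q → α → Option Q
  final : Set Q

/-- Extended (partial) transition function on words. -/
def DetAut.run {Q : Type*} (A : DetAut α Q) (q : Q) (w : List α) : Option Q :=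
  w.foldlM A.step q

/-- The word language accepted by the DFA. -/
def DetAut.lang {Q : Type*} (A : DetAut α Q) : Set (List α) :=
  {w | ∃ qf ∈ A.final, A.run A.init w = some qf}

/-- The diamond property of a DFA with respect to the independence relation. -/
def DetAut.Diamond {Q : Type*} [DecidableEq P] (loc : α → Finset P)
    (A : DetAut α Q) : Prop :=
  ∀ a b q q' q'', loc a ∩ loc b = ∅ →
    A.step q a = some q' → A.step q' b = some q'' →
    ∃ q''', A.step q b = some q''' ∧ A.step q''' a = some q''

def DetAut.Reachable {Q : Type*} (A : DetAut α Q) (q : Q) : Prop :=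
  ∃ w, A.run A.init w = some q

def DetAut.Coreachable {Q : Type*} (A : DetAut α Q) (q : Q) : Prop :=
  ∃ w qf, A.run q w = some qf ∧ qf ∈ A.final

/-- A DFA is `k`-fair. -/
def DetAut.KFair {Q : Type*} [DecidableEq P] [Fintype P] (loc : α → Finset P)
    (A : DetAut α Q) (k : ℕ) : Prop :=
  ∀ q, A.Reachable q → ∀ u q', k ≤ u.length → A.run q u = some q' →
    A.Coreachable q' → locWord loc u = Finset.univ

theorem DetAut.run_append {Q : Type*} (A : DetAut α Q) (q : Q) (u v : List α) :
    A.run q (u ++ v) = (A.run q u).bind (fun r => A.run r v) := by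
  simp [DetAut.run, List.foldlM_append]

theorem locWord_append [DecidableEq P] (loc : α → Finset P) (u v : List α) :
    locWord loc (u ++ v) = locWord loc u ∪ locWord loc v := by
  induction u with
  | nil => simp [locWord]
  | cons a u ih =>
    have h : ∀ w, locWord loc (a :: w) = loc a ∪ locWord loc w := fun _ => rfl
    rw [List.cons_append, h, h, ih, Finset.union_assoc]

theorem DetAut.pump {Q : Type*} [DecidableEq P] (loc : α → Finset P) (A : DetAut α Q)
    (p : Q) (y : List α) (hy : A.run p y = some p) (hpos : 1 ≤ y.length) (n : ℕ) :
    ∃ w, n ≤ w.length ∧ A.run p w = some p ∧ locWord loc w ⊆ locWord loc y := by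
  induction n with
  | zero => exact ⟨[], by simp, rfl, by simp [locWord]⟩
  | succ n ih =>
    obtain ⟨w, h1, h2, h3⟩ := ih
    refine ⟨w ++ y, by simp; omega, by simp [DetAut.run_append, h2, hy], ?_⟩
    rw [locWord_append]
    exact Finset.union_subset h3 subset_rfl

/-- A trim DFA satisfying the diamond property is `k`-fair
for some `k ≥ 1` iff it is `|Q|`-fair. -/
theorem kfair_iff_cardfair {Q : Type*} [DecidableEq P]
    [Fintype α] [Fintype P] [Fintype Q]
    (loc : α → Finset P) (hloc : ∀ a, (loc a).Nonempty)
    (A : DetAut α Q) (hdiam : A.Diamond loc)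
    (htrim : ∀ q : Q, A.Reachable q ∧ A.Coreachable q) :
    (∃ k, 1 ≤ k ∧ A.KFair loc k) ↔ A.KFair loc (Fintype.card Q) := by
  constructor
  · rintro ⟨k, -, hk⟩ q - u q' hlen hrun -
    have hpre : ∀ i, ∃ r, A.run q (u.take i) = some r := by
      intro i
      rw [← List.take_append_drop i u, DetAut.run_append] at hrun
      obtain ⟨r, hr, -⟩ := Option.bind_eq_some_iff.1 hrun
      exact ⟨r, hr⟩
    choose f hf using hpre
    have key : ∃ i j, i < j ∧ j ≤ u.length ∧ f i = f j := by
      obtain ⟨a, b, hab, h⟩ := Fintype.exists_ne_map_eq_of_card_lt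
        (fun i : Fin (u.length + 1) => f i) (by simp; omega)
      rcases lt_or_gt_of_ne hab with h' | h'
      · exact ⟨a, b, h', by omega, h⟩
      · exact ⟨b, a, h', by omega, h.symm⟩
    obtain ⟨i, j, hij, hj, hfe⟩ := key
    have hsplit : u.take j = u.take i ++ (u.take j).drop i := by
      conv_lhs => rw [← List.take_append_drop i (u.take j), List.take_take, min_eq_left hij.le]
    have hy : A.run (f i) ((u.take j).drop i) = some (f i) := by
      have := hf j
      rw [hsplit, DetAut.run_append, hf i, ← hfe] at this
      simpa using this
    obtain ⟨w, h1, h2, h3⟩ := A.pump loc (f i) _ hy (by simp; omega) k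
    have h4 := hk (f i) (htrim _).1 w _ h1 h2 (htrim _).2
    rw [h4] at h3
    apply Finset.univ_subset_iff.1
    rw [← List.take_append_drop j u, hsplit, locWord_append, locWord_append]
    intro x hx
    simp only [Finset.mem_union]
    exact Or.inl (Or.inr (h3 hx))
  · intro h
    exact ⟨_, Fintype.card_pos_iff.2 ⟨A.init⟩, h⟩
end
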